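/- Let G be a finite simple graph, let C = {1,2,3,4} be a set of 4 colors, and consider a position (a partial proper coloring of G with colors from C) with Bob to move. Suppose G contains a path P = v_0 v_1 … v_d all of whose vertices are uncolored, where each vertex of P has degree at least 2 and has at least 8 uncolored pendant neighbors, |Φ(v_0)| ≥ 2, and v_d lies on a cycle of odd length all of whose vertices are uncolored and each of whose vertices has at least 8 uncolored pendant neighbors, the cycle meeting P only in v_d. Then Bob has a winning strategy (in one move he can create a winning cycle-path). -/

import Mathlib

namespace GCN

/-- The player whose turn it is. -/
inductive Player : Type
  | alice : Player
  | bob : Player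

variable {V α : Type}

/-- A move consisting of coloring the uncolored vertex `v` with color `a` is legal in the
partial coloring `c` if `v` is uncolored and no neighbor of `v` has color `a`. -/
def legalMove (G : SimpleGraph V) (c : V → Option α) (v : V) (a : α) : Prop :=
  c v = none ∧ ∀ u, G.Adj v u → c u ≠ some a

/-- The partial coloring obtained by coloring vertex `v` with color `a`. -/
def applyMove [DecidableEq V] (c : V → Option α) (v : V) (a : α) : V → Option α :=
  Function.update c v (some a)

/-- `BobWins G p c` : in the coloring game on `G` starting from the partial coloring `c` with
player `p` to move (the moving player must color an uncolored vertex properly whenever a legal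
move exists; the game ends when no legal move exists), Bob has a strategy guaranteeing that the
game ends with some vertex uncolored. -/
inductive BobWins [DecidableEq V] (G : SimpleGraph V) : Player → (V → Option α) → Prop
  | endPos (p : Player) (c : V → Option α)
      (hend : ∀ v a, ¬ legalMove G c v a) (hunc : ∃ v, c v = none) : BobWins G p c
  | aliceMove (c : V → Option α)
      (hmoves : ∃ v a, legalMove G c v a)
      (h : ∀ v a, legalMove G c v a → BobWins G .bob (applyMove c v a)) :
      BobWins G .alice c
  | bobMove (c : V → Option α) (v : V) (a : α)
      (hmove : legalMove G c v a)
      (h : BobWins G .alice (applyMove c v a)) : BobWins G .bob c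

/-- `AliceWins G p c` : in the coloring game on `G` starting from the partial coloring `c` with
player `p` to move, Alice has a strategy guaranteeing that the game ends with all vertices
colored. -/
inductive AliceWins [DecidableEq V] (G : SimpleGraph V) : Player → (V → Option α) → Prop
  | endPos (p : Player) (c : V → Option α)
      (hend : ∀ v a, ¬ legalMove G c v a) (hall : ∀ v, c v ≠ none) : AliceWins G p c
  | aliceMove (c : V → Option α) (v : V) (a : α)
      (hmove : legalMove G c v a)
      (h : AliceWins G .bob (applyMove c v a)) : AliceWins G .alice c
  | bobMove (c : V → Option α)
      (hmoves : ∃ v a, legalMove G c v a)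
      (h : ∀ v a, legalMove G c v a → AliceWins G .alice (applyMove c v a)) :
      AliceWins G .bob c

/-- The game chromatic number of `G` : the least number `k` of colors such that Alice has a
winning strategy in the coloring game on `G` played with `k` colors (Alice moving first,
starting from the everywhere-uncolored position). -/
noncomputable def gameChromaticNumber [DecidableEq V] (G : SimpleGraph V) : ℕ :=
  sInf {k : ℕ | AliceWins (α := Fin k) G .alice (fun _ => none)}

/-- `c` is a partial proper coloring of `G` : adjacent colored vertices get distinct colors. -/
def ProperPartial (G : SimpleGraph V) (c : V → Option α) : Prop :=
  ∀ ⦃u v : V⦄, G.Adj u v → ∀ a : α, c u = some a → c v ≠ some a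

/-- `Phi G c v` : the set of colors appearing (under `c`) on the neighbors of `v`. -/
def Phi (G : SimpleGraph V) (c : V → Option α) (v : V) : Set α :=
  {a : α | ∃ u, G.Adj v u ∧ c u = some a}

end GCN

namespace GCN

section Strategy

variable {V : Type} {G : SimpleGraph V} {p : ℕ → V} {i j k : ℕ}
  {c : V → Option (Fin 4)} {v w : V} {a : Fin 4}

/-- `p i, …, p j` is a path of `G`. -/
structure IsSeg (G : SimpleGraph V) (p : ℕ → V) (i j : ℕ) : Prop where
  adj : ∀ k, i ≤ k → k < j → G.Adj (p k) (p (k + 1))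
  inj : ∀ k l, i ≤ k → k ≤ j → i ≤ l → l ≤ j → p k = p l → k = l

lemma IsSeg.mono {i' j' : ℕ} (h : IsSeg G p i j) (hi : i ≤ i') (hj : j' ≤ j) :
    IsSeg G p i' j' where
  adj k h1 h2 := h.adj k (by omega) (by omega)
  inj k l h1 h2 h3 h4 := h.inj k l (by omega) (by omega) (by omega) (by omega)

lemma legalMove_iff : legalMove G c v a ↔ c v = none ∧ a ∉ Phi G c v := by
  simp [legalMove, Phi]

variable [DecidableEq V]

lemma applyMove_self : applyMove c v a v = some a := by
  simp [applyMove]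

lemma applyMove_of_ne (h : w ≠ v) : applyMove c v a w = c w := by
  simp [applyMove, h]

lemma applyMove_eq_none : applyMove c v a w = none ↔ w ≠ v ∧ c w = none := by
  by_cases h : w = v
  · subst h; simp [applyMove]
  · simp [applyMove, h]

lemma Phi_subset_applyMove (hv : c v = none) : Phi G c w ⊆ Phi G (applyMove c v a) w := by
  rintro x ⟨y, hy, hx⟩
  refine ⟨y, hy, ?_⟩
  rwa [applyMove_of_ne]
  rintro rfl
  simp [hv] at hx

lemma mem_Phi_applyMove (h : G.Adj w v) : a ∈ Phi G (applyMove c v a) w :=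
  ⟨v, h, applyMove_self⟩

/-- An uncolored vertex that sees every color is never colored. -/
theorem bobWins_of_Phi_eq_univ [Fintype V] (p : Player) (c : V → Option (Fin 4)) (hv : c v = none)
    (h : ∀ a, a ∈ Phi G c v) : BobWins G p c := by
  induction hn : {x | c x = none}.ncard using Nat.strong_induction_on generalizing p c with
  | _ n ih =>
    by_cases hm : ∃ x a, legalMove G c x a
    · have key : ∀ q x a, legalMove G c x a → BobWins G q (applyMove c x a) := by
        intro q x a hx
        have hxv : v ≠ x := by
          rintro rfl
          exact (legalMove_iff.1 hx).2 (h a)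
        refine ih _ ?_ q _ (applyMove_eq_none.2 ⟨hxv, hv⟩)
          (fun b => Phi_subset_applyMove hx.1 (h b)) rfl
        rw [← hn]
        refine Set.ncard_lt_ncard ⟨fun y hy => (applyMove_eq_none.1 hy).2, fun hs => ?_⟩
          (Set.toFinite _)
        exact (applyMove_eq_none.1 (hs hx.1)).1 rfl
      cases p with
      | alice => exact .aliceMove c hm (key .bob)
      | bob =>
        obtain ⟨x, a, hx⟩ := hm
        exact .bobMove c x a hx (key .alice x a hx)
    · push Not at hm
      exact .endPos p c hm ⟨v, hv⟩

end Strategy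

section Strategy

variable {V : Type} [Fintype V] {G : SimpleGraph V} [DecidableRel G.Adj]
  {c : V → Option (Fin 4)} {u v w : V} {a : Fin 4}

/-- `IsFreeLeaf G c v u` : `u` is an uncolored pendant neighbor of `v`. -/
def IsFreeLeaf (G : SimpleGraph V) [DecidableRel G.Adj] (c : V → Option (Fin 4)) (v u : V) :
    Prop :=
  G.Adj v u ∧ G.degree u = 1 ∧ c u = none

/-- The number of uncolored pendant neighbors of `v`. -/
noncomputable def freeLeaves (G : SimpleGraph V) [DecidableRel G.Adj] (c : V → Option (Fin 4))
    (v : V) : ℕ :=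
  {u : V | IsFreeLeaf G c v u}.ncard

lemma eq_of_adj_of_degree_eq_one (hu : G.degree u = 1) (hv : G.Adj v u) (hw : G.Adj w u) :
    v = w :=
  (SimpleGraph.degree_eq_one_iff_existsUnique_adj.1 hu).unique hv.symm hw.symm

lemma freeLeaves_le_degree : freeLeaves G c v ≤ G.degree v := by
  rw [← SimpleGraph.card_neighborFinset_eq_degree, ← Set.ncard_coe_finset]
  exact Set.ncard_le_ncard (fun u hu => by simpa using hu.1) (Set.toFinite _)

lemma exists_isFreeLeaf (h : 1 ≤ freeLeaves G c v) : ∃ u, IsFreeLeaf G c v u :=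
  Set.nonempty_of_ncard_ne_zero (by rw [freeLeaves] at h; exact Nat.one_le_iff_ne_zero.1 h)

lemma IsFreeLeaf.ne_of_two_le (hu : IsFreeLeaf G c v u) (h : 2 ≤ freeLeaves G c w) : w ≠ u := by
  rintro rfl
  have := freeLeaves_le_degree (G := G) (c := c) (v := w)
  have := hu.2.1
  omega

lemma IsFreeLeaf.legalMove (hu : IsFreeLeaf G c v u) (hv : c v = none) :
    legalMove G c u a :=
  ⟨hu.2.2, fun w hw => by
    rw [eq_of_adj_of_degree_eq_one hu.2.1 hw.symm hu.1, hv]; simp⟩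

variable [DecidableEq V]

lemma freeLeaves_le_applyMove_add_one :
    freeLeaves G c w ≤ freeLeaves G (applyMove c v a) w + 1 := by
  have hsub : {u : V | IsFreeLeaf G c w u} ⊆
      insert v {u : V | IsFreeLeaf G (applyMove c v a) w u} := by
    intro u hu
    by_cases h : u = v
    · exact Or.inl h
    · exact Or.inr ⟨hu.1, hu.2.1, applyMove_eq_none.2 ⟨h, hu.2.2⟩⟩
  exact (Set.ncard_le_ncard hsub (Set.toFinite _)).trans (Set.ncard_insert_le _ _)

lemma freeLeaves_le_applyMove (h : ¬ (G.Adj w v ∧ G.degree v = 1)) :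
    freeLeaves G c w ≤ freeLeaves G (applyMove c v a) w := by
  refine Set.ncard_le_ncard (fun u hu => ?_) (Set.toFinite _)
  refine ⟨hu.1, hu.2.1, applyMove_eq_none.2 ⟨?_, hu.2.2⟩⟩
  rintro rfl
  exact h ⟨hu.1, hu.2.1⟩

lemma freeLeaves_le_applyMove_of_two_le {b : Fin 4} (h : 2 ≤ freeLeaves G c v) :
    freeLeaves G c w ≤ freeLeaves G (applyMove c v b) w := by
  refine freeLeaves_le_applyMove fun h1 => ?_
  have := freeLeaves_le_degree (G := G) (c := c) (v := v)
  omega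

lemma IsFreeLeaf.freeLeaves_le (hu : IsFreeLeaf G c v u) (h : w ≠ v) :
    freeLeaves G c w ≤ freeLeaves G (applyMove c u a) w :=
  freeLeaves_le_applyMove fun h1 => h (eq_of_adj_of_degree_eq_one h1.2 h1.1 hu.1)

/-- Bob wins if he is to move and some uncolored vertex with a free leaf misses at most one
color. -/
theorem bobWins_of_missing_le_one {b : Fin 4} (hv : c v = none) (hl : 1 ≤ freeLeaves G c v)
    (h : ∀ a, a ≠ b → a ∈ Phi G c v) : BobWins G .bob c := by
  obtain ⟨u, hu⟩ := exists_isFreeLeaf hl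
  refine .bobMove c u b (hu.legalMove hv)
    (bobWins_of_Phi_eq_univ (v := v) _ _ (applyMove_eq_none.2 ⟨hu.1.ne, hv⟩) fun a => ?_)
  by_cases hab : a = b
  · subst hab
    exact mem_Phi_applyMove hu.1
  · exact Phi_subset_applyMove hu.2.2 (h a hab)

/-- If an uncolored vertex `v` with enough free leaves sees two colors, Bob can force Alice
to color `v` immediately. -/
theorem bobWins_of_forcing {T : Finset (Fin 4)} (hT : T.card = 2) (hv : c v = none)
    (hl : 3 ≤ freeLeaves G c v) (hTv : ∀ x ∈ T, x ∈ Phi G c v)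
    (h : ∀ u b a, IsFreeLeaf G c v u → a ∉ T →
      BobWins G .bob (applyMove (applyMove c u b) v a)) : BobWins G .bob c := by
  obtain ⟨b, b', hbb⟩ : ∃ b b', ∀ x, x ∉ T → x = b ∨ x = b' := by
    clear h hTv; revert T; decide
  obtain ⟨u, hu⟩ := exists_isFreeLeaf (by omega : 1 ≤ freeLeaves G c v)
  refine .bobMove c u b (hu.legalMove hv) ?_
  have hv' : applyMove c u b v = none := applyMove_eq_none.2 ⟨hu.1.ne, hv⟩
  have hl' := freeLeaves_le_applyMove_add_one (G := G) (c := c) (w := v) (v := u) (a := b)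
  have hΦ : ∀ a, a ≠ b' → a ∈ Phi G (applyMove c u b) v := by
    intro a ha
    by_cases haT : a ∈ T
    · exact Phi_subset_applyMove hu.2.2 (hTv a haT)
    · obtain rfl : a = b := (hbb a haT).resolve_right ha
      exact mem_Phi_applyMove hu.1
  obtain ⟨u', hu'⟩ := exists_isFreeLeaf (by omega : 1 ≤ freeLeaves G (applyMove c u b) v)
  refine .aliceMove _ ⟨u', b, hu'.legalMove hv'⟩ fun y a hy => ?_
  by_cases hyv : y = v
  · subst hyv
    refine h u b a hu fun haT => ?_
    exact (legalMove_iff.1 hy).2 (Phi_subset_applyMove hu.2.2 (hTv a haT))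
  · have := freeLeaves_le_applyMove_add_one (G := G) (c := applyMove c u b) (w := v) (v := y)
      (a := a)
    exact bobWins_of_missing_le_one (v := v) (b := b')
      (applyMove_eq_none.2 ⟨fun h => hyv h.symm, hv'⟩) (by omega)
      fun x hx => Phi_subset_applyMove hy.1 (hΦ x hx)

/-- If `v` sees one of the two colors of `T`, Bob can make it see both. -/
theorem bobWins_of_completing {T : Finset (Fin 4)} (hT : T.card = 2) (hv : c v = none)
    (hl : 1 ≤ freeLeaves G c v) (haT : a ∈ T) (ha : a ∈ Phi G c v)
    (h : ∀ u b, IsFreeLeaf G c v u → (∀ x ∈ T, x ∈ Phi G (applyMove c u b) v) →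
      BobWins G .alice (applyMove c u b)) : BobWins G .bob c := by
  obtain ⟨b, hb⟩ : ∃ b, ∀ x ∈ T, x = a ∨ x = b := by
    clear h ha; revert T a; decide
  obtain ⟨u, hu⟩ := exists_isFreeLeaf hl
  refine .bobMove c u b (hu.legalMove hv) (h u b hu fun x hx => ?_)
  rcases hb x hx with rfl | rfl
  · exact Phi_subset_applyMove hu.2.2 ha
  · exact mem_Phi_applyMove hu.1

/-- The color class `S` or its complement, according to the parity of `k`. -/
def side (S : Finset (Fin 4)) (k : ℕ) : Finset (Fin 4) := if Even k then S else Sᶜ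

variable {S : Finset (Fin 4)} {p : ℕ → V} {i j k : ℕ}

lemma mem_side_succ : a ∈ side S (k + 1) ↔ a ∉ side S k := by
  by_cases h : Even k <;> simp [side, h, Nat.even_add_one]

lemma card_side (hS : S.card = 2) (k : ℕ) : (side S k).card = 2 := by
  unfold side
  split_ifs
  · exact hS
  · rw [Finset.card_compl, hS]; rfl

lemma side_congr {l : ℕ} (h : k % 2 = l % 2) : side S k = side S l := by
  have : Even k ↔ Even l := by rw [Nat.even_iff, Nat.even_iff, h]
  simp [side, this]

/-- The uncolored path `p i, …, p j` is a trap for Alice when she is to move: each end sees the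
two colors that an alternating pattern along the path prescribes for it. -/
structure IsTrap (G : SimpleGraph V) [DecidableRel G.Adj] (p : ℕ → V) (S : Finset (Fin 4))
    (i j : ℕ) (c : V → Option (Fin 4)) : Prop where
  uncolored : ∀ k, i ≤ k → k ≤ j → c (p k) = none
  inner : ∀ k, i < k → k < j → 6 ≤ freeLeaves G c (p k)
  leavesLeft : i < j → 4 ≤ freeLeaves G c (p i)
  leavesRight : i < j → 4 ≤ freeLeaves G c (p j)
  left : ∀ x ∈ side S i, x ∈ Phi G c (p i)
  right : ∀ x ∈ side S (j + 1), x ∈ Phi G c (p j)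

/-- Bob to move completes a trap at its right end. -/
lemma bobWins_of_completing_right (hS : S.card = 2) (hij : i ≤ j) (hp : IsSeg G p i j)
    (htrap : ∀ c', IsTrap G p S i j c' → BobWins G .alice c')
    (hunc : ∀ k, i ≤ k → k ≤ j → c (p k) = none)
    (hinner : ∀ k, i < k → k < j → 6 ≤ freeLeaves G c (p k))
    (hleft : i < j → 4 ≤ freeLeaves G c (p i))
    (hone : 1 ≤ freeLeaves G c (p j)) (hright : i < j → 5 ≤ freeLeaves G c (p j))
    (hsat : ∀ x ∈ side S i, x ∈ Phi G c (p i))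
    (ha : a ∈ side S (j + 1)) (haΦ : a ∈ Phi G c (p j)) : BobWins G .bob c := by
  refine bobWins_of_completing (card_side hS (j + 1)) (hunc j hij le_rfl) hone ha haΦ
    fun u b hu hsat' => htrap _ ?_
  have hne : ∀ k, i ≤ k → k < j → p k ≠ p j := fun k h1 h2 h =>
    absurd (hp.inj k j h1 h2.le hij le_rfl h) h2.ne
  have hle := freeLeaves_le_applyMove_add_one (G := G) (c := c) (w := p j) (v := u) (a := b)
  refine ⟨fun k h1 h2 => ?_, fun k h1 h2 => ?_, fun h => ?_, fun h => ?_, fun x hx => ?_, hsat'⟩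
  · refine applyMove_eq_none.2 ⟨?_, hunc k h1 h2⟩
    rcases h2.eq_or_lt with rfl | h2
    · exact hu.1.ne
    · rcases h1.eq_or_lt with rfl | h1
      · exact hu.ne_of_two_le (by have := hleft h2; omega)
      · exact hu.ne_of_two_le (by have := hinner k h1 h2; omega)
  · exact (hinner k h1 h2).trans (hu.freeLeaves_le (hne k h1.le h2))
  · exact (hleft h).trans (hu.freeLeaves_le (hne i le_rfl h))
  · have := hright h
    omega
  · exact Phi_subset_applyMove hu.2.2 (hsat x hx)

/-- Bob to move completes a trap at its left end. -/
lemma bobWins_of_completing_left (hS : S.card = 2) (hij : i ≤ j) (hp : IsSeg G p i j)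
    (htrap : ∀ c', IsTrap G p S i j c' → BobWins G .alice c')
    (hunc : ∀ k, i ≤ k → k ≤ j → c (p k) = none)
    (hinner : ∀ k, i < k → k < j → 6 ≤ freeLeaves G c (p k))
    (hone : 1 ≤ freeLeaves G c (p i)) (hleft : i < j → 5 ≤ freeLeaves G c (p i))
    (hright : i < j → 4 ≤ freeLeaves G c (p j))
    (hsat : ∀ x ∈ side S (j + 1), x ∈ Phi G c (p j))
    (ha : a ∈ side S i) (haΦ : a ∈ Phi G c (p i)) : BobWins G .bob c := by
  refine bobWins_of_completing (card_side hS i) (hunc i le_rfl hij) hone ha haΦ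
    fun u b hu hsat' => htrap _ ?_
  have hne : ∀ k, i < k → k ≤ j → p k ≠ p i := fun k h1 h2 h =>
    absurd (hp.inj k i h1.le h2 le_rfl hij h) h1.ne'
  have hle := freeLeaves_le_applyMove_add_one (G := G) (c := c) (w := p i) (v := u) (a := b)
  refine ⟨fun k h1 h2 => ?_, fun k h1 h2 => ?_, fun h => ?_, fun h => ?_, hsat', fun x hx => ?_⟩
  · refine applyMove_eq_none.2 ⟨?_, hunc k h1 h2⟩
    rcases h1.eq_or_lt with rfl | h1
    · exact hu.1.ne
    · rcases h2.eq_or_lt with rfl | h2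
      · exact hu.ne_of_two_le (by have := hright h1; omega)
      · exact hu.ne_of_two_le (by have := hinner k h1 h2; omega)
  · exact (hinner k h1 h2).trans (hu.freeLeaves_le (hne k h1 h2.le))
  · have := hleft h
    omega
  · exact (hright h).trans (hu.freeLeaves_le (hne j h le_rfl))
  · exact Phi_subset_applyMove hu.2.2 (hsat x hx)

/-- Bob wins when Alice is to move in a trap. -/
theorem IsTrap.bobWins (hS : S.card = 2) (hij : i ≤ j) (hp : IsSeg G p i j)
    (h : IsTrap G p S i j c) : BobWins G .alice c := by
  induction hn : j - i using Nat.strong_induction_on generalizing i j c with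
  | _ n ih =>
  rcases hij.eq_or_lt with rfl | hlt
  · refine bobWins_of_Phi_eq_univ (v := p i) _ _ (h.uncolored i le_rfl le_rfl) fun a => ?_
    by_cases ha : a ∈ side S i
    · exact h.left a ha
    · exact h.right a (mem_side_succ.2 ha)
  have hleaf : ∀ k, i ≤ k → k ≤ j → 4 ≤ freeLeaves G c (p k) := by
    intro k h1 h2
    rcases h1.eq_or_lt with rfl | h1
    · exact h.leavesLeft hlt
    rcases h2.eq_or_lt with rfl | h2
    · exact h.leavesRight hlt
    · have := h.inner k h1 h2
      omega
  have htrap : ∀ {i' j' : ℕ}, i ≤ i' → j' ≤ j → i' ≤ j' → j' - i' < j - i →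
      ∀ c', IsTrap G p S i' j' c' → BobWins G .alice c' :=
    fun h1 h2 h3 h4 c' hc' => ih _ (hn ▸ h4) h3 (hp.mono h1 h2) hc' rfl
  -- A color `a ∉ side S k` at `p k` leaves Bob a nearly complete trap to the right of `p k`;
  -- the next fact is the mirror image.
  have hpeel : ∀ c' k a, i ≤ k → k < j → a ∉ side S k → (∀ l, k < l → l ≤ j → c' (p l) = none) →
      (∀ l, k < l → l < j → 6 ≤ freeLeaves G c' (p l)) → 4 ≤ freeLeaves G c' (p j) →
      (∀ x ∈ side S (j + 1), x ∈ Phi G c' (p j)) → a ∈ Phi G c' (p (k + 1)) →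
      BobWins G .bob c' := by
    intro c' k a h1 h2 ha hunc hin hr hsat hΦ
    have hin' : ∀ h : k + 1 < j, 6 ≤ freeLeaves G c' (p (k + 1)) :=
      fun h => hin _ (by omega) h
    refine bobWins_of_completing_left (i := k + 1) hS h2 (hp.mono (by omega) le_rfl)
      (htrap (by omega) le_rfl h2 (by omega)) (fun l h3 h4 => hunc l (by omega) h4)
      (fun l h3 h4 => hin l (by omega) h4) ?_ (fun h => (by omega : 5 ≤ 6).trans (hin' h))
      (fun _ => hr) hsat (mem_side_succ.2 ha) hΦ
    by_cases he : k + 1 = j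
    · rw [he]
      omega
    · have := hin' (by omega)
      omega
  have hpeel' : ∀ c' k a, i ≤ k → k < j → a ∈ side S (k + 1) →
      (∀ l, i ≤ l → l ≤ k → c' (p l) = none) →
      (∀ l, i < l → l ≤ k → 6 ≤ freeLeaves G c' (p l)) → 4 ≤ freeLeaves G c' (p i) →
      (∀ x ∈ side S i, x ∈ Phi G c' (p i)) → a ∈ Phi G c' (p k) →
      BobWins G .bob c' := by
    intro c' k a h1 h2 ha hunc hin hl hsat hΦ
    refine bobWins_of_completing_right hS h1 (hp.mono le_rfl h2.le)
      (htrap le_rfl h2.le h1 (by omega)) hunc (fun l h3 h4 => hin l h3 h4.le)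
      (fun _ => hl) ?_ (fun h => (by omega : 5 ≤ 6).trans (hin k h le_rfl)) hsat ha hΦ
    rcases h1.eq_or_lt with rfl | h1
    · omega
    · have := hin k h1 le_rfl
      omega
  have hforce : ∀ c', (∀ l, i ≤ l → l ≤ j → c' (p l) = none) →
      (∀ l, i < l → l < j → 6 ≤ freeLeaves G c' (p l)) → 3 ≤ freeLeaves G c' (p i) →
      4 ≤ freeLeaves G c' (p j) → (∀ x ∈ side S i, x ∈ Phi G c' (p i)) →
      (∀ x ∈ side S (j + 1), x ∈ Phi G c' (p j)) → BobWins G .bob c' := by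
    intro c' hunc hin hl hr hsatl hsatr
    refine bobWins_of_forcing (card_side hS i) (hunc i le_rfl hij) hl hsatl
      fun u b x hu hx => ?_
    have hle := freeLeaves_le_applyMove_add_one (G := G) (c := c') (w := p i) (v := u) (a := b)
    have hne : ∀ l, i < l → l ≤ j → p l ≠ p i := fun l h3 h4 h5 =>
      h3.ne' (hp.inj l i h3.le h4 le_rfl hij h5)
    have hfl : ∀ w, w ≠ p i →
        freeLeaves G c' w ≤ freeLeaves G (applyMove (applyMove c' u b) (p i) x) w :=
      fun w hw => (hu.freeLeaves_le hw).trans (freeLeaves_le_applyMove_of_two_le (by omega))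
    have hun : applyMove c' u b (p i) = none := applyMove_eq_none.2 ⟨hu.1.ne, hunc i le_rfl hij⟩
    refine hpeel _ i x le_rfl hlt hx (fun l h3 h4 => ?_)
      (fun l h3 h4 => (hin l h3 h4).trans (hfl _ (hne l h3 h4.le)))
      (hr.trans (hfl _ (hne j hlt le_rfl)))
      (fun z hz => Phi_subset_applyMove hun (Phi_subset_applyMove hu.2.2 (hsatr z hz)))
      (mem_Phi_applyMove (hp.adj i le_rfl hlt).symm)
    refine applyMove_eq_none.2 ⟨hne l h3 h4, applyMove_eq_none.2
      ⟨hu.ne_of_two_le ?_, hunc l h3.le h4⟩⟩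
    rcases h4.eq_or_lt with rfl | h4
    · omega
    · have := hin l h3 h4
      omega
  have hforce' : ∀ c', (∀ l, i ≤ l → l ≤ j → c' (p l) = none) →
      (∀ l, i < l → l < j → 6 ≤ freeLeaves G c' (p l)) → 4 ≤ freeLeaves G c' (p i) →
      3 ≤ freeLeaves G c' (p j) → (∀ x ∈ side S i, x ∈ Phi G c' (p i)) →
      (∀ x ∈ side S (j + 1), x ∈ Phi G c' (p j)) → BobWins G .bob c' := by
    intro c' hunc hin hl hr hsatl hsatr
    refine bobWins_of_forcing (card_side hS (j + 1)) (hunc j hij le_rfl) hr hsatr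
      fun u b x hu hx => ?_
    have hle := freeLeaves_le_applyMove_add_one (G := G) (c := c') (w := p j) (v := u) (a := b)
    have hne : ∀ l, i ≤ l → l < j → p l ≠ p j := fun l h3 h4 h5 =>
      h4.ne (hp.inj l j h3 h4.le hij le_rfl h5)
    have hfl : ∀ w, w ≠ p j →
        freeLeaves G c' w ≤ freeLeaves G (applyMove (applyMove c' u b) (p j) x) w :=
      fun w hw => (hu.freeLeaves_le hw).trans (freeLeaves_le_applyMove_of_two_le (by omega))
    have hun : applyMove c' u b (p j) = none := applyMove_eq_none.2 ⟨hu.1.ne, hunc j hij le_rfl⟩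
    obtain ⟨m, rfl⟩ : ∃ m, j = m + 1 := ⟨j - 1, by omega⟩
    rw [mem_side_succ, not_not] at hx
    refine hpeel' _ m x (by omega) (by omega) hx (fun l h3 h4 => ?_)
      (fun l h3 h4 => (hin l h3 (by omega)).trans (hfl _ (hne l h3.le (by omega))))
      (hl.trans (hfl _ (hne i le_rfl hlt)))
      (fun z hz => Phi_subset_applyMove hun (Phi_subset_applyMove hu.2.2 (hsatl z hz)))
      (mem_Phi_applyMove (hp.adj m (by omega) (by omega)))
    refine applyMove_eq_none.2 ⟨hne l h3 (by omega), applyMove_eq_none.2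
      ⟨hu.ne_of_two_le ?_, hunc l h3 (by omega)⟩⟩
    rcases h3.eq_or_lt with rfl | h3
    · omega
    · have := hin l h3 (by omega)
      omega
  obtain ⟨u₀, hu₀⟩ := exists_isFreeLeaf (by have := hleaf i le_rfl hij; omega :
    1 ≤ freeLeaves G c (p i))
  refine .aliceMove c ⟨u₀, 0, hu₀.legalMove (h.uncolored i le_rfl hij)⟩ fun y a hy => ?_
  by_cases hyp : ∃ k, i ≤ k ∧ k ≤ j ∧ y = p k
  · obtain ⟨k, h1, h2, rfl⟩ := hyp
    have hfl : ∀ w, freeLeaves G c w ≤ freeLeaves G (applyMove c (p k) a) w := fun w =>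
      freeLeaves_le_applyMove_of_two_le (by have := hleaf k h1 h2; omega)
    have hunc : ∀ l, i ≤ l → l ≤ j → l ≠ k → applyMove c (p k) a (p l) = none :=
      fun l h3 h4 h5 => applyMove_eq_none.2
        ⟨fun h6 => h5 (hp.inj l k h3 h4 h1 h2 h6), h.uncolored l h3 h4⟩
    have haΦ := (legalMove_iff.1 hy).2
    by_cases ha : a ∈ side S k
    · have hik : i ≠ k := by
        rintro rfl
        exact haΦ (h.left a ha)
      obtain ⟨k, rfl⟩ : ∃ k', k = k' + 1 := ⟨k - 1, by omega⟩
      exact hpeel' _ k a (by omega) (by omega) ha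
        (fun l h3 h4 => hunc l h3 (by omega) (by omega))
        (fun l h3 h4 => (h.inner l h3 (by omega)).trans (hfl _))
        ((h.leavesLeft hlt).trans (hfl _))
        (fun x hx => Phi_subset_applyMove hy.1 (h.left x hx))
        (mem_Phi_applyMove (hp.adj k (by omega) (by omega)))
    · have hkj : k ≠ j := by
        rintro rfl
        exact haΦ (h.right a (mem_side_succ.2 ha))
      exact hpeel _ k a h1 (by omega) ha
        (fun l h3 h4 => hunc l (by omega) h4 (by omega))
        (fun l h3 h4 => (h.inner l (by omega) h4).trans (hfl _))
        ((h.leavesRight hlt).trans (hfl _))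
        (fun x hx => Phi_subset_applyMove hy.1 (h.right x hx))
        (mem_Phi_applyMove (hp.adj k h1 (by omega)).symm)
  have hunc : ∀ l, i ≤ l → l ≤ j → applyMove c y a (p l) = none :=
    fun l h3 h4 => applyMove_eq_none.2 ⟨fun h5 => hyp ⟨l, h3, h4, h5.symm⟩, h.uncolored l h3 h4⟩
  have hleft : ∀ x ∈ side S i, x ∈ Phi G (applyMove c y a) (p i) :=
    fun x hx => Phi_subset_applyMove hy.1 (h.left x hx)
  have hright : ∀ x ∈ side S (j + 1), x ∈ Phi G (applyMove c y a) (p j) :=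
    fun x hx => Phi_subset_applyMove hy.1 (h.right x hx)
  have hfl1 : ∀ w, freeLeaves G c w ≤ freeLeaves G (applyMove c y a) w + 1 :=
    fun w => freeLeaves_le_applyMove_add_one
  by_cases hyl : ∃ k, i ≤ k ∧ k ≤ j ∧ IsFreeLeaf G c (p k) y
  · obtain ⟨k, h1, h2, hyk⟩ := hyl
    have hfl : ∀ l, i ≤ l → l ≤ j → l ≠ k →
        freeLeaves G c (p l) ≤ freeLeaves G (applyMove c y a) (p l) := fun l h3 h4 h5 =>
      hyk.freeLeaves_le fun h6 => h5 (hp.inj l k h3 h4 h1 h2 h6)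
    have hk4 := hleaf k h1 h2
    have hk1 := hfl1 (p k)
    have haΦ : a ∈ Phi G (applyMove c y a) (p k) := mem_Phi_applyMove hyk.1
    rcases h2.eq_or_lt with rfl | h2
    · exact hforce' _ hunc
        (fun l h3 h4 => (h.inner l h3 h4).trans (hfl l h3.le h4.le h4.ne))
        ((h.leavesLeft hlt).trans (hfl i le_rfl hij hlt.ne)) (by omega) hleft hright
    rcases h1.eq_or_lt with rfl | h1
    · exact hforce _ hunc
        (fun l h3 h4 => (h.inner l h3 h4).trans (hfl l h3.le h4.le h3.ne'))
        (by omega) ((h.leavesRight hlt).trans (hfl j hij le_rfl hlt.ne')) hleft hright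
    · -- Alice used a leaf of an inner vertex: Bob continues with the part it cuts off.
      have h6 := h.inner k h1 h2
      by_cases ha : a ∈ side S (k + 1)
      · refine bobWins_of_completing_right hS h1.le (hp.mono le_rfl h2.le)
          (htrap le_rfl h2.le h1.le (by omega)) (fun l h3 h4 => hunc l h3 (by omega))
          (fun l h3 h4 => (h.inner l h3 (by omega)).trans (hfl l h3.le (by omega) (by omega)))
          (fun _ => (h.leavesLeft hlt).trans (hfl i le_rfl hij (by omega))) (by omega)
          (fun _ => by omega) hleft ha haΦ
      · refine bobWins_of_completing_left hS h2.le (hp.mono h1.le le_rfl)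
          (htrap h1.le le_rfl h2.le (by omega)) (fun l h3 h4 => hunc l (by omega) h4)
          (fun l h3 h4 => (h.inner l (by omega) h4).trans
            (hfl l (by omega) (by omega) (by omega)))
          (by omega) (fun _ => by omega)
          (fun _ => (h.leavesRight hlt).trans (hfl j hij le_rfl (by omega))) hright
          (by rw [mem_side_succ] at ha; exact not_not.1 ha) haΦ
  · have hfl : ∀ l, i ≤ l → l ≤ j →
        freeLeaves G c (p l) ≤ freeLeaves G (applyMove c y a) (p l) := fun l h3 h4 =>
      freeLeaves_le_applyMove fun h5 => hyl ⟨l, h3, h4, h5.1, h5.2, hy.1⟩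
    exact hforce _ hunc
      (fun l h3 h4 => (h.inner l h3 h4).trans (hfl l h3.le h4.le))
      (((by omega : 3 ≤ 4).trans (h.leavesLeft hlt)).trans (hfl i le_rfl hij))
      ((h.leavesRight hlt).trans (hfl j hij le_rfl)) hleft hright

/-- Bob wins when he is to move and a path with many free leaves lacks one color at its right
end to be a trap. -/
lemma bobWins_of_isSeg (hS : S.card = 2) (hij : i ≤ j) (hp : IsSeg G p i j)
    (hunc : ∀ k, i ≤ k → k ≤ j → c (p k) = none)
    (hleaf : ∀ k, i ≤ k → k ≤ j → 6 ≤ freeLeaves G c (p k))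
    (hsat : ∀ x ∈ side S i, x ∈ Phi G c (p i))
    (ha : a ∈ side S (j + 1)) (haΦ : a ∈ Phi G c (p j)) : BobWins G .bob c := by
  have hi := hleaf i le_rfl hij
  have hj := hleaf j hij le_rfl
  exact bobWins_of_completing_right hS hij hp (fun _ h => h.bobWins hS hij hp) hunc
    (fun k h1 h2 => hleaf k h1.le h2.le) (fun _ => by omega) (by omega) (fun _ => by omega)
    hsat ha haΦ

/-- Bob wins when Alice is to move, the path `p i, …, p d` is followed by the odd cycle
`p d, …, p (d + 2 * m + 2)`, its first vertex `p i` sees two colors, and the vertex `p (d + 1)`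
of the cycle sees a color matching the alternating pattern along the path. -/
theorem bobWins_of_lasso (hS : S.card = 2) {d m : ℕ} (hp : IsSeg G p 0 (d + 2 * m + 2))
    (hclose : G.Adj (p d) (p (d + 2 * m + 2))) {b : Fin 4} (hi : i ≤ d)
    (hunc : ∀ k, i ≤ k → k ≤ d + 2 * m + 2 → c (p k) = none)
    (hleaf : ∀ k, i ≤ k → k ≤ d + 2 * m + 2 → 7 ≤ freeLeaves G c (p k))
    (hpath : ∀ k, i < k → k ≤ d → 8 ≤ freeLeaves G c (p k))
    (hsat : ∀ x ∈ side S i, x ∈ Phi G c (p i))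
    (hb : b ∈ side S (d + 2)) (hbΦ : b ∈ Phi G c (p (d + 1))) : BobWins G .alice c := by
  induction hn : d - i using Nat.strong_induction_on generalizing i c with
  | _ n ih =>
  obtain ⟨u₀, hu₀⟩ := exists_isFreeLeaf (by have := hleaf i le_rfl (by omega); omega :
    1 ≤ freeLeaves G c (p i))
  refine .aliceMove c ⟨u₀, 0, hu₀.legalMove (hunc i le_rfl (by omega))⟩ fun y a hy => ?_
  have hmono : ∀ w, Phi G c w ⊆ Phi G (applyMove c y a) w := fun _ => Phi_subset_applyMove hy.1
  by_cases hyp : ∃ k, i ≤ k ∧ k ≤ d + 1 ∧ y = p k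
  swap
  · refine bobWins_of_isSeg hS (by omega) (hp.mono (Nat.zero_le i) (by omega : d + 1 ≤ _))
      (fun k h1 h2 => applyMove_eq_none.2
        ⟨fun h => hyp ⟨k, h1, h2, h.symm⟩, hunc k h1 (by omega)⟩) (fun k h1 h2 => ?_)
      (fun x hx => hmono _ (hsat x hx)) hb (hmono _ hbΦ)
    have := hleaf k h1 (by omega)
    have := freeLeaves_le_applyMove_add_one (G := G) (c := c) (w := p k) (v := y) (a := a)
    omega
  obtain ⟨k, h1, h2, rfl⟩ := hyp
  have hfl : ∀ w, freeLeaves G c w ≤ freeLeaves G (applyMove c (p k) a) w := fun w =>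
    freeLeaves_le_applyMove_of_two_le (by have := hleaf k h1 (by omega); omega)
  have hleaf' : ∀ l, i ≤ l → l ≤ d + 2 * m + 2 →
      6 ≤ freeLeaves G (applyMove c (p k) a) (p l) :=
    fun l h3 h4 => (by omega : 6 ≤ 7).trans ((hleaf l h3 h4).trans (hfl _))
  have hunc' : ∀ l, i ≤ l → l ≤ d + 2 * m + 2 → l ≠ k → applyMove c (p k) a (p l) = none :=
    fun l h3 h4 h5 => applyMove_eq_none.2
      ⟨fun h6 => h5 (hp.inj l k (Nat.zero_le _) h4 (Nat.zero_le _) (by omega) h6), hunc l h3 h4⟩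
  by_cases ha : a ∈ side S k
  · have hik : i ≠ k := by
      rintro rfl
      exact (legalMove_iff.1 hy).2 (hsat a ha)
    obtain ⟨k, rfl⟩ : ∃ k', k = k' + 1 := ⟨k - 1, by omega⟩
    exact bobWins_of_isSeg hS (by omega) (hp.mono (Nat.zero_le i) (by omega : k ≤ _))
      (fun l h3 h4 => hunc' l h3 (by omega) (by omega)) (fun l h3 h4 => hleaf' l h3 (by omega))
      (fun x hx => hmono _ (hsat x hx)) ha
      (mem_Phi_applyMove (hp.adj k (Nat.zero_le _) (by omega)))
  have ha' := mem_side_succ.2 ha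
  rcases lt_trichotomy k d with h3 | rfl | h3
  · -- Bob restores the situation on the shorter path starting at `p (k + 1)`.
    refine bobWins_of_completing (card_side hS (k + 1))
      (hunc' (k + 1) (by omega) (by omega) (by omega))
      ((by omega : 1 ≤ 6).trans (hleaf' _ (by omega) (by omega))) ha'
      (mem_Phi_applyMove (hp.adj k (Nat.zero_le _) (by omega)).symm) fun u x hu hsat' => ?_
    have hne : ∀ l, l ≤ d + 2 * m + 2 → l ≠ k + 1 → p l ≠ p (k + 1) := fun l h4 h5 h6 =>
      h5 (hp.inj l (k + 1) (Nat.zero_le _) h4 (Nat.zero_le _) (by omega) h6)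
    refine ih (d - (k + 1)) (by omega) (i := k + 1) (by omega) (fun l h4 h5 => ?_)
      (fun l h4 h5 => ?_) (fun l h4 h5 => ?_) hsat'
      (Phi_subset_applyMove hu.2.2 (hmono _ hbΦ)) rfl
    · exact applyMove_eq_none.2 ⟨hu.ne_of_two_le
        ((by omega : 2 ≤ 6).trans (hleaf' l (by omega) h5)), hunc' l (by omega) h5 (by omega)⟩
    · by_cases h6 : l = k + 1
      · subst h6
        have := hpath (k + 1) (by omega) (by omega)
        have := hfl (p (k + 1))
        have := freeLeaves_le_applyMove_add_one (G := G) (c := applyMove c (p k) a)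
          (w := p (k + 1)) (v := u) (a := x)
        omega
      · exact ((hleaf l (by omega) h5).trans (hfl _)).trans (hu.freeLeaves_le (hne l h5 h6))
    · exact ((hpath l (by omega) h5).trans (hfl _)).trans
        (hu.freeLeaves_le (hne l (by omega) (by omega)))
  · -- The rest of the cycle is a path with odd length whose ends both see `a`.
    have hab : a ≠ b := by
      rintro rfl
      exact mem_side_succ.1 hb ha'
    have hside : side (side {a, b} (k + 1)) (k + 1) = {a, b} := by
      unfold side
      split_ifs <;> simp
    refine bobWins_of_isSeg (S := side {a, b} (k + 1)) (card_side (Finset.card_pair hab) _)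
      (by omega) (hp.mono (Nat.zero_le (k + 1)) le_rfl)
      (fun l h4 h5 => hunc' l (by omega) h5 (by omega)) (fun l h4 h5 => hleaf' l (by omega) h5)
      (fun x hx => ?_) (a := a) ?_ (mem_Phi_applyMove hclose.symm)
    · rw [hside, Finset.mem_insert, Finset.mem_singleton] at hx
      rcases hx with rfl | rfl
      · exact mem_Phi_applyMove (hp.adj k (Nat.zero_le _) (by omega)).symm
      · exact hmono _ hbΦ
    · rw [side_congr (by omega : _ % 2 = (k + 1) % 2), hside]
      simp
  · -- Bob uses the path that goes around the cycle in the other direction.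
    obtain rfl : k = d + 1 := by omega
    let σ : ℕ → ℕ := fun l => if l ≤ d then l else 2 * d + 2 * m + 3 - l
    have hσ : ∀ l, i ≤ l → l ≤ d + 2 * m + 1 →
        i ≤ σ l ∧ σ l ≤ d + 2 * m + 2 ∧ σ l ≠ d + 1 := by
      intro l h4 h5
      simp only [σ]
      split_ifs <;> omega
    have hq : IsSeg G (p ∘ σ) i (d + 2 * m + 1) := by
      refine ⟨fun l h4 h5 => ?_, fun l l' h4 h5 h6 h7 h8 => ?_⟩
      · rcases lt_trichotomy l d with h6 | rfl | h6
        · simpa [σ, h6.le, Nat.succ_le_of_lt h6] using hp.adj l (Nat.zero_le _) (by omega)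
        · have : 2 * l + 2 * m + 3 - (l + 1) = l + 2 * m + 2 := by omega
          simpa [σ, this] using hclose
        · have := hp.adj (2 * d + 2 * m + 3 - (l + 1)) (Nat.zero_le _) (by omega)
          rw [show 2 * d + 2 * m + 3 - (l + 1) + 1 = 2 * d + 2 * m + 3 - l by omega] at this
          simpa [σ, show ¬ l ≤ d by omega, show ¬ l + 1 ≤ d by omega] using this.symm
      · have := hp.inj (σ l) (σ l') (Nat.zero_le _) (hσ l h4 h5).2.1 (Nat.zero_le _)
          (hσ l' h6 h7).2.1 h8
        simp only [σ] at this
        split_ifs at this <;> omega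
    refine bobWins_of_isSeg hS (by omega) hq
      (fun l h4 h5 => hunc' _ (hσ l h4 h5).1 (hσ l h4 h5).2.1 (hσ l h4 h5).2.2)
      (fun l h4 h5 => hleaf' _ (hσ l h4 h5).1 (hσ l h4 h5).2.1) (fun x hx => ?_) (a := a) ?_ ?_
    · simpa [σ, hi] using hmono _ (hsat x hx)
    · rwa [side_congr (by omega : _ % 2 = (d + 1 + 1) % 2)]
    · have : σ (d + 2 * m + 1) = d + 1 + 1 := by
        simp only [σ]
        split_ifs <;> omega
      rw [Function.comp_apply, this]
      exact mem_Phi_applyMove (hp.adj (d + 1) (Nat.zero_le _) (by omega)).symm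

end Strategy

section Walk

variable {V : Type} {G : SimpleGraph V} {s t : V}

/-- The vertices of a walk `P` followed by those of a walk `Q` starting where `P` ends. -/
def walkThen (P : G.Walk s t) (Q : G.Walk t t) (k : ℕ) : V :=
  if k ≤ P.length then P.getVert k else Q.getVert (k - P.length)

variable {P : G.Walk s t} {Q : G.Walk t t}

lemma walkThen_of_le {k : ℕ} (h : k ≤ P.length) : walkThen P Q k = P.getVert k := by
  simp [walkThen, h]

lemma walkThen_length_add (k : ℕ) : walkThen P Q (P.length + k) = Q.getVert k := by
  rcases k.eq_zero_or_pos with rfl | hk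
  · simp [walkThen]
  · simp [walkThen, show k ≠ 0 by omega]

lemma isSeg_walkThen (hP : P.IsPath) (hQ : Q.IsCycle)
    (hmeet : ∀ v ∈ P.support, v ∈ Q.support → v = t) {n : ℕ} (hn : n < Q.length) :
    IsSeg G (walkThen P Q) 0 (P.length + n) := by
  have hcross : ∀ k l, k ≤ P.length → l ≤ n → P.getVert k = Q.getVert l → l = 0 := by
    intro k l hk hl h
    by_contra h0
    have ht : Q.getVert l = Q.getVert Q.length := by
      rw [Q.getVert_length]
      exact hmeet _ (h ▸ P.getVert_mem_support k) (Q.getVert_mem_support l)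
    have := hQ.getVert_injOn (x₁ := l) (x₂ := Q.length) ⟨by omega, by omega⟩
      ⟨by omega, le_rfl⟩ ht
    omega
  refine ⟨fun k _ hk => ?_, fun k l _ hk _ hl h => ?_⟩
  · by_cases h : k < P.length
    · rw [walkThen_of_le h.le, walkThen_of_le h]
      exact P.adj_getVert_succ h
    · obtain ⟨k, rfl⟩ := Nat.exists_eq_add_of_le (not_lt.1 h)
      rw [add_assoc, walkThen_length_add, walkThen_length_add]
      exact Q.adj_getVert_succ (by omega)
  · rcases le_or_gt k P.length with hk' | hk' <;> rcases le_or_gt l P.length with hl' | hl'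
    · rw [walkThen_of_le hk', walkThen_of_le hl'] at h
      exact hP.getVert_injOn hk' hl' h
    · obtain ⟨l, rfl⟩ := Nat.exists_eq_add_of_le hl'.le
      rw [walkThen_of_le hk', walkThen_length_add] at h
      have := hcross k l hk' (by omega) h
      omega
    · obtain ⟨k, rfl⟩ := Nat.exists_eq_add_of_le hk'.le
      rw [walkThen_of_le hl', walkThen_length_add] at h
      have := hcross l k hl' (by omega) h.symm
      omega
    · obtain ⟨k, rfl⟩ := Nat.exists_eq_add_of_le hk'.le
      obtain ⟨l, rfl⟩ := Nat.exists_eq_add_of_le hl'.le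
      rw [walkThen_length_add, walkThen_length_add] at h
      have := hQ.getVert_injOn (x₁ := k) (x₂ := l) ⟨by omega, by omega⟩
        ⟨by omega, by omega⟩ h
      omega

lemma walkThen_mem {k : ℕ} : walkThen P Q k ∈ P.support ∨ walkThen P Q k ∈ Q.support := by
  unfold walkThen
  split_ifs
  · exact Or.inl (P.getVert_mem_support _)
  · exact Or.inr (Q.getVert_mem_support _)

end Walk

end GCN

open GCN in
/-- With 4 colors (`Fin 4`), suppose the position `c` is a partial proper coloring, Bob to
move, and `G` contains a path `P` from `v₀` to `v_d` all of whose vertices are uncolored, have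
degree at least 2 and have at least 8 uncolored pendant neighbors, with `|Φ(v₀)| ≥ 2`, and
`v_d` lies on an odd cycle, all of whose vertices are uncolored and have at least 8 uncolored
pendant neighbors, meeting `P` only in `v_d`.  Then Bob (to move) wins. -/
theorem statement8 {V : Type} [Fintype V] [DecidableEq V]
    (G : SimpleGraph V) [DecidableRel G.Adj]
    (c : V → Option (Fin 4)) (hc : ProperPartial G c)
    {v₀ vd : V} (P : G.Walk v₀ vd) (hP : P.IsPath)
    (huncolP : ∀ v ∈ P.support, c v = none)
    (hdegP : ∀ v ∈ P.support, 2 ≤ G.degree v)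
    (hleavesP : ∀ v ∈ P.support,
      8 ≤ {u : V | G.Adj v u ∧ G.degree u = 1 ∧ c u = none}.ncard)
    (h₀ : 2 ≤ (Phi G c v₀).ncard)
    (Cyc : G.Walk vd vd) (hCyc : Cyc.IsCycle) (hodd : Odd Cyc.length)
    (huncolC : ∀ v ∈ Cyc.support, c v = none)
    (hleavesC : ∀ v ∈ Cyc.support,
      8 ≤ {u : V | G.Adj v u ∧ G.degree u = 1 ∧ c u = none}.ncard)
    (hmeet : ∀ v ∈ P.support, v ∈ Cyc.support → v = vd) :
    BobWins G .bob c := by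
  set p := walkThen P Cyc with hp_def
  obtain ⟨m, hm⟩ : ∃ m, Cyc.length = 2 * m + 3 := by
    obtain ⟨k, hk⟩ := hodd
    have := hCyc.three_le_length
    exact ⟨k - 1, by omega⟩
  have hp : IsSeg G p 0 (P.length + 2 * m + 2) :=
    isSeg_walkThen hP hCyc hmeet (n := 2 * m + 2) (by omega)
  have hclose : G.Adj (p P.length) (p (P.length + 2 * m + 2)) := by
    have h := Cyc.adj_getVert_succ (i := 2 * m + 2) (by omega)
    rw [← hm, Cyc.getVert_length] at h
    rw [hp_def, walkThen_of_le le_rfl, P.getVert_length, add_assoc, walkThen_length_add]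
    exact h.symm
  have hunc : ∀ k, c (p k) = none := fun k =>
    walkThen_mem.elim (huncolP (p k)) (huncolC (p k))
  have hleaf : ∀ k, 8 ≤ freeLeaves G c (p k) := fun k =>
    walkThen_mem.elim (hleavesP (p k)) (hleavesC (p k))
  obtain ⟨S, hSsub, hS⟩ : ∃ S : Finset (Fin 4), (∀ x ∈ S, x ∈ Phi G c v₀) ∧ S.card = 2 := by
    obtain ⟨T, hT, hT2⟩ := Set.exists_subset_card_eq h₀
    refine ⟨T.toFinite.toFinset, fun x hx => hT (by simpa using hx), ?_⟩
    rw [← Set.ncard_eq_toFinset_card, hT2]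
  obtain ⟨b, hb⟩ : (side S (P.length + 2)).Nonempty := by
    rw [← Finset.card_pos, card_side hS]
    omega
  obtain ⟨u, hu⟩ := exists_isFreeLeaf ((by omega : 1 ≤ 8).trans (hleaf (P.length + 1)))
  refine .bobMove c u b (hu.legalMove (hunc _)) (bobWins_of_lasso hS hp hclose (Nat.zero_le _)
    (fun k _ _ => applyMove_eq_none.2
      ⟨hu.ne_of_two_le ((by omega : 2 ≤ 8).trans (hleaf k)), hunc k⟩)
    (fun k _ _ => ?_) (fun k _ hk => (hleaf k).trans (hu.freeLeaves_le fun h => ?_))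
    (fun x hx => Phi_subset_applyMove hu.2.2 ?_) hb (mem_Phi_applyMove hu.1))
  · have := hleaf k
    have := freeLeaves_le_applyMove_add_one (G := G) (c := c) (w := p k) (v := u) (a := b)
    omega
  · have := hp.inj k (P.length + 1) (Nat.zero_le _) (by omega) (Nat.zero_le _) (by omega) h
    omega
  · rw [hp_def, walkThen_of_le (Nat.zero_le _), P.getVert_zero]
    exact hSsub x (by simpa [side] using hx)
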